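/- Let $P$ be a probability measure on $\mathbb{R}$ with bounded support, and for $r \ge 0$ define $\psi(r) = \mathbb{E}_{x^*, z}\log \int \exp(\sqrt{r} z x + r x x^* - \tfrac{r}{2}x^2)\,dP(x)$, where $z \sim \mathcal{N}(0,1)$ and $x^* \sim P$ are independent. Then $\psi(0) = 0$, $\psi'(0) = \tfrac{1}{2}(\mathbb{E}_P[X])^2$, and if $P$ is centered, $\psi''(0) = \tfrac{1}{2}(\mathbb{E}_P[X^2])^2$. -/

import Mathlib

open MeasureTheory ProbabilityTheory

open Set Filter Topology

section Moments

variable {P : Measure ℝ} {K : ℝ}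

/-- The `k`-th moment of `P` against the unnormalised Gibbs weight `exp (a x - r x² / 2)`,
as a function of `p = (a, r)`. -/
noncomputable def gibbsMoment (P : Measure ℝ) (k : ℕ) (p : ℝ × ℝ) : ℝ :=
  ∫ x, x ^ k * Real.exp (p.1 * x - p.2 / 2 * x ^ 2) ∂P

/-- The Gibbs average of `x ^ k`. -/
noncomputable def gibbsMean (P : Measure ℝ) (k : ℕ) (p : ℝ × ℝ) : ℝ :=
  gibbsMoment P k p / gibbsMoment P 0 p

lemma abs_pow_mul_exp_le {A R x : ℝ} (k : ℕ) {p : ℝ × ℝ} (hx : |x| ≤ K) (hA : |p.1| ≤ A)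
    (hR : |p.2| ≤ R) :
    |x ^ k * Real.exp (p.1 * x - p.2 / 2 * x ^ 2)| ≤ K ^ k * Real.exp (A * K + R / 2 * K ^ 2) := by
  have hK : 0 ≤ K := (abs_nonneg x).trans hx
  have hA0 : 0 ≤ A := (abs_nonneg _).trans hA
  rw [abs_mul, abs_pow, Real.abs_exp]
  have h1 : p.1 * x ≤ A * K :=
    (le_abs_self _).trans ((abs_mul _ _).le.trans (mul_le_mul hA hx (abs_nonneg _) hA0))
  have h2 : -(p.2 / 2 * x ^ 2) ≤ R / 2 * K ^ 2 := by
    have hx2 : x ^ 2 ≤ K ^ 2 := sq_le_sq' (abs_le.1 hx).1 (abs_le.1 hx).2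
    nlinarith [(abs_le.1 hR).1, mul_le_mul hR hx2 (sq_nonneg x) ((abs_nonneg _).trans hR),
      neg_abs_le p.2, sq_nonneg x]
  gcongr
  linarith

lemma integrable_pow_mul_exp [IsProbabilityMeasure P] (hK : ∀ᵐ x ∂P, |x| ≤ K) (k : ℕ)
    (p : ℝ × ℝ) :
    Integrable (fun x ↦ x ^ k * Real.exp (p.1 * x - p.2 / 2 * x ^ 2)) P :=
  Integrable.of_bound (by fun_prop) _
    (hK.mono fun _ hx ↦ abs_pow_mul_exp_le k hx le_rfl le_rfl)

lemma gibbsMoment_zero_pos [IsProbabilityMeasure P] (hK : ∀ᵐ x ∂P, |x| ≤ K) (p : ℝ × ℝ) :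
    0 < gibbsMoment P 0 p := by
  have h := integrable_pow_mul_exp hK 0 p
  simp only [gibbsMoment, pow_zero, one_mul] at h ⊢
  exact integral_exp_pos h

lemma abs_gibbsMean_le [IsProbabilityMeasure P] (hK : ∀ᵐ x ∂P, |x| ≤ K) (k : ℕ) (p : ℝ × ℝ) :
    |gibbsMean P k p| ≤ K ^ k := by
  have hpos := gibbsMoment_zero_pos hK p
  rw [gibbsMean, abs_div, abs_of_pos hpos, div_le_iff₀ hpos]
  have h0 := integrable_pow_mul_exp hK 0 p
  simp only [gibbsMoment, ← integral_const_mul, ← Real.norm_eq_abs]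
  refine norm_integral_le_of_norm_le (h0.const_mul _) (hK.mono fun x hx ↦ ?_)
  rw [Real.norm_eq_abs, abs_mul, abs_pow, Real.abs_exp, pow_zero, one_mul]
  gcongr

lemma hasFDerivAt_gibbsMoment [IsProbabilityMeasure P] (hK : ∀ᵐ x ∂P, |x| ≤ K) (k : ℕ)
    (p : ℝ × ℝ) :
    HasFDerivAt (gibbsMoment P k)
      (gibbsMoment P (k + 1) p • ContinuousLinearMap.fst ℝ ℝ ℝ
        + (-(gibbsMoment P (k + 2) p / 2)) • ContinuousLinearMap.snd ℝ ℝ ℝ) p := by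
  let w : ℝ × ℝ → ℝ → ℝ := fun q x ↦ Real.exp (q.1 * x - q.2 / 2 * x ^ 2)
  let F' : ℝ × ℝ → ℝ → (ℝ × ℝ →L[ℝ] ℝ) := fun q x ↦
    (x ^ (k + 1) * w q x) • ContinuousLinearMap.fst ℝ ℝ ℝ
      + (-1 / 2 * (x ^ (k + 2) * w q x)) • ContinuousLinearMap.snd ℝ ℝ ℝ
  let B : ℕ → ℝ := fun j ↦
    K ^ j * Real.exp ((|p.1| + 1) * K + (|p.2| + 1) / 2 * K ^ 2)
  have key : HasFDerivAt (gibbsMoment P k) (∫ x, F' p x ∂P) p := by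
    refine hasFDerivAt_integral_of_dominated_of_fderiv_le (s := Metric.ball p 1)
      (bound := fun _ ↦ B (k + 1) + B (k + 2)) (Metric.ball_mem_nhds p one_pos)
      (.of_forall fun q ↦ (integrable_pow_mul_exp hK k q).aestronglyMeasurable)
      (integrable_pow_mul_exp hK k p) ?_ ?_ (integrable_const _) ?_
    · simp only [F', w]; fun_prop
    · filter_upwards [hK] with x hx q hq
      rw [Metric.mem_ball, Prod.dist_eq, max_lt_iff, Real.dist_eq, Real.dist_eq] at hq
      have h1 : |q.1| ≤ |p.1| + 1 := by linarith [abs_sub_abs_le_abs_sub q.1 p.1]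
      have h2 : |q.2| ≤ |p.2| + 1 := by linarith [abs_sub_abs_le_abs_sub q.2 p.2]
      have b1 := abs_pow_mul_exp_le (k + 1) hx h1 h2
      have b2 := abs_pow_mul_exp_le (k + 2) hx h1 h2
      refine (norm_add_le _ _).trans (add_le_add ?_ ?_)
      · rw [norm_smul, Real.norm_eq_abs]
        nlinarith [ContinuousLinearMap.norm_fst_le (𝕜 := ℝ) ℝ ℝ, norm_nonneg
          (ContinuousLinearMap.fst ℝ ℝ ℝ), abs_nonneg (x ^ (k + 1) * w q x)]
      · rw [norm_smul, Real.norm_eq_abs, abs_mul]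
        have : |(-1 / 2 : ℝ)| = 1 / 2 := by norm_num [abs_div]
        rw [this]
        nlinarith [ContinuousLinearMap.norm_snd_le (𝕜 := ℝ) ℝ ℝ, norm_nonneg
          (ContinuousLinearMap.snd ℝ ℝ ℝ), abs_nonneg (x ^ (k + 2) * w q x)]
    · refine .of_forall fun x q _ ↦ ?_
      have h1 : HasFDerivAt (fun q : ℝ × ℝ ↦ q.1 * x - q.2 / 2 * x ^ 2)
          (x • ContinuousLinearMap.fst ℝ ℝ ℝ - (x ^ 2 / 2) • ContinuousLinearMap.snd ℝ ℝ ℝ) q := by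
        have e : (fun q : ℝ × ℝ ↦ q.1 * x - q.2 / 2 * x ^ 2) =
            ⇑(x • ContinuousLinearMap.fst ℝ ℝ ℝ - (x ^ 2 / 2) • ContinuousLinearMap.snd ℝ ℝ ℝ) := by
          ext q; simp; ring
        rw [e]; exact ContinuousLinearMap.hasFDerivAt _
      refine (h1.exp.const_mul (x ^ k)).congr_fderiv ?_
      ext <;> simp [F', w] <;> ring
  refine key.congr_fderiv ?_
  simp only [F', w]
  have i1 := integrable_pow_mul_exp hK (k + 1) p
  have i2 := (integrable_pow_mul_exp hK (k + 2) p).const_mul (-1 / 2)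
  rw [integral_add (i1.smul_const _) (i2.smul_const _), integral_smul_const, integral_smul_const,
    integral_const_mul]
  simp only [gibbsMoment]
  congr 2; ring

lemma hasFDerivAt_log_gibbsMoment [IsProbabilityMeasure P] (hK : ∀ᵐ x ∂P, |x| ≤ K) (p : ℝ × ℝ) :
    HasFDerivAt (fun q ↦ Real.log (gibbsMoment P 0 q))
      (gibbsMean P 1 p • ContinuousLinearMap.fst ℝ ℝ ℝ
        + (-(gibbsMean P 2 p / 2)) • ContinuousLinearMap.snd ℝ ℝ ℝ) p := by
  refine ((hasFDerivAt_gibbsMoment hK 0 p).log (gibbsMoment_zero_pos hK p).ne').congr_fderiv ?_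
  ext <;> simp [gibbsMean] <;> ring

lemma hasFDerivAt_gibbsMean [IsProbabilityMeasure P] (hK : ∀ᵐ x ∂P, |x| ≤ K) (k : ℕ)
    (p : ℝ × ℝ) :
    HasFDerivAt (gibbsMean P k)
      ((gibbsMean P (k + 1) p - gibbsMean P k p * gibbsMean P 1 p) • ContinuousLinearMap.fst ℝ ℝ ℝ
        + (-((gibbsMean P (k + 2) p - gibbsMean P k p * gibbsMean P 2 p) / 2)) •
          ContinuousLinearMap.snd ℝ ℝ ℝ) p := by
  have hpos := (gibbsMoment_zero_pos hK p).ne'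
  have hinv := (hasDerivAt_inv hpos).comp_hasFDerivAt p (hasFDerivAt_gibbsMoment hK 0 p)
  refine ((hasFDerivAt_gibbsMoment hK k p).mul hinv).congr_fderiv ?_
  ext <;> simp [gibbsMean] <;> field_simp <;> ring

lemma continuous_gibbsMean [IsProbabilityMeasure P] (hK : ∀ᵐ x ∂P, |x| ≤ K) (k : ℕ) :
    Continuous (gibbsMean P k) :=
  continuous_iff_continuousAt.2 fun p ↦ (hasFDerivAt_gibbsMean hK k p).continuousAt

lemma gibbsMean_zero_right [IsProbabilityMeasure P] (k : ℕ) :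
    gibbsMean P k 0 = ∫ x, x ^ k ∂P := by
  simp [gibbsMean, gibbsMoment]

end Moments

lemma hasDerivAt_fst_of_hasFDerivAt {f : ℝ × ℝ → ℝ} {A B a r : ℝ}
    (h : HasFDerivAt f (A • ContinuousLinearMap.fst ℝ ℝ ℝ + B • ContinuousLinearMap.snd ℝ ℝ ℝ)
      (a, r)) : HasDerivAt (fun t ↦ f (t, r)) A a := by
  refine (h.comp_hasDerivAt a ((hasDerivAt_id a).prodMk (hasDerivAt_const a r))).congr_deriv ?_
  simp

/-- Gaussian integration by parts. -/
lemma integral_mul_gaussianReal_eq_integral_deriv {g g' : ℝ → ℝ} {C : ℝ}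
    (hg : ∀ z, HasDerivAt g (g' z) z) (hg' : Measurable g') (hC : ∀ z, |g z| ≤ C)
    (hC' : ∀ z, |g' z| ≤ C) :
    ∫ z, g z * z ∂(gaussianReal 0 1) = ∫ z, g' z ∂(gaussianReal 0 1) := by
  have hgc : Continuous g := continuous_iff_continuousAt.2 fun z ↦ (hg z).continuousAt
  have hpdf : gaussianPDFReal 0 1 = fun z ↦ (√(2 * Real.pi))⁻¹ * Real.exp (-z ^ 2 / 2) := by
    ext z; simp [gaussianPDFReal]
  have hd (z : ℝ) : HasDerivAt (gaussianPDFReal 0 1) (-(gaussianPDFReal 0 1 z * z)) z := by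
    rw [hpdf]
    have h1 : HasDerivAt (fun z : ℝ ↦ -z ^ 2 / 2) (-z) z := by
      refine (((hasDerivAt_pow 2 z).neg).div_const 2).congr_deriv ?_
      simp; ring
    exact (h1.exp.const_mul _).congr_deriv (by ring)
  have hp := integrable_gaussianPDFReal 0 1
  have hz : Integrable (fun z ↦ gaussianPDFReal 0 1 z * z) := by
    have := (memLp_id_gaussianReal (μ := 0) (v := 1) 1).integrable (by simp)
    rw [gaussianReal_of_var_ne_zero _ one_ne_zero,
      integrable_withDensity_iff_integrable_smul' (measurable_gaussianPDF 0 1)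
        (.of_forall fun _ ↦ gaussianPDF_lt_top)] at this
    simpa [toReal_gaussianPDF] using this
  have key := integral_mul_deriv_eq_deriv_mul_of_integrable (u := g) (u' := g')
    (v := gaussianPDFReal 0 1) (v' := fun z ↦ -(gaussianPDFReal 0 1 z * z))
    (fun z _ ↦ hg z) (fun z _ ↦ hd z)
    (hz.neg.bdd_mul hgc.aestronglyMeasurable (.of_forall hC))
    (hp.bdd_mul hg'.aestronglyMeasurable (.of_forall hC'))
    (hp.bdd_mul hgc.aestronglyMeasurable (.of_forall hC))
  rw [integral_gaussianReal_eq_integral_smul one_ne_zero,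
    integral_gaussianReal_eq_integral_smul one_ne_zero]
  simp only [smul_eq_mul, mul_neg, integral_neg, neg_inj] at key ⊢
  rw [show (fun z ↦ gaussianPDFReal 0 1 z * g' z) = fun z ↦ g' z * gaussianPDFReal 0 1 z by
    ext; ring, ← key]
  congr 1; ext; ring

section Heat

variable {P : Measure ℝ} {K C : ℝ} {f fa faa fr : ℝ → ℝ × ℝ → ℝ}

lemma abs_le_of_hasFDerivAt {g ga gr : ℝ × ℝ → ℝ}
    (hg : ∀ p, HasFDerivAt g (ga p • ContinuousLinearMap.fst ℝ ℝ ℝ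
      + gr p • ContinuousLinearMap.snd ℝ ℝ ℝ) p)
    (h0 : |g 0| ≤ C) (hga : ∀ p, |ga p| ≤ C) (hgr : ∀ p, |gr p| ≤ C) (p : ℝ × ℝ) :
    |g p| ≤ C + 2 * C * (|p.1| + |p.2|) := by
  have hC : 0 ≤ C := (abs_nonneg _).trans h0
  have key := convex_univ.norm_image_sub_le_of_norm_hasFDerivWithin_le (C := 2 * C)
    (fun q _ ↦ (hg q).hasFDerivWithinAt) (fun q _ ↦ ?_) (mem_univ (0 : ℝ × ℝ)) (mem_univ p)
  · have h1 : ‖p‖ ≤ |p.1| + |p.2| := by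
      rw [Prod.norm_def]
      exact max_le (le_add_of_nonneg_right (abs_nonneg _)) (le_add_of_nonneg_left (abs_nonneg _))
    rw [sub_zero, Real.norm_eq_abs] at key
    nlinarith [abs_sub_abs_le_abs_sub (g p) (g 0)]
  · rw [two_mul]
    refine (norm_add_le _ _).trans (add_le_add ?_ ?_) <;> rw [norm_smul, Real.norm_eq_abs]
    · exact (mul_le_of_le_one_right (abs_nonneg _) (ContinuousLinearMap.norm_fst_le ..)).trans
        (hga q)
    · exact (mul_le_of_le_one_right (abs_nonneg _) (ContinuousLinearMap.norm_snd_le ..)).trans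
        (hgr q)

/-- The point at which the observables are evaluated; `w = (x*, z)`. -/
noncomputable def channelPoint (r : ℝ) (w : ℝ × ℝ) : ℝ × ℝ := (√r * w.2 + r * w.1, r)

lemma continuous_channelPoint : Continuous fun q : ℝ × ℝ × ℝ ↦ channelPoint q.1 q.2 := by
  unfold channelPoint; fun_prop

lemma ae_abs_fst_le (hK : ∀ᵐ x ∂P, |x| ≤ K) :
    ∀ᵐ w ∂(P.prod (gaussianReal 0 1)), |w.1| ≤ K :=
  Measure.quasiMeasurePreserving_fst.ae hK

lemma integrable_abs_snd [IsProbabilityMeasure P] :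
    Integrable (fun w : ℝ × ℝ ↦ |w.2|) (P.prod (gaussianReal 0 1)) :=
  (((memLp_id_gaussianReal (μ := 0) (v := 1) 1).integrable (by simp)).abs).comp_snd P

lemma abs_comp_channelPoint_le
    (hf : ∀ y p, HasFDerivAt (f y) (fa y p • ContinuousLinearMap.fst ℝ ℝ ℝ
      + fr y p • ContinuousLinearMap.snd ℝ ℝ ℝ) p)
    (h0 : ∀ y, |y| ≤ K → |f y 0| ≤ C) (hba : ∀ y p, |y| ≤ K → |fa y p| ≤ C)
    (hbr : ∀ y p, |y| ≤ K → |fr y p| ≤ C) {r R : ℝ} (hr : 0 ≤ r) (hrR : r ≤ R) {w : ℝ × ℝ}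
    (hw : |w.1| ≤ K) :
    |f w.1 (channelPoint r w)| ≤ C + 2 * C * (√R * |w.2| + R * K + R) := by
  have hC : 0 ≤ C := (abs_nonneg _).trans (h0 _ hw)
  refine (abs_le_of_hasFDerivAt (hf w.1) (h0 _ hw) (hba _ · hw) (hbr _ · hw) _).trans ?_
  have hR : 0 ≤ R := hr.trans hrR
  have h1 : |√r * w.2 + r * w.1| ≤ √R * |w.2| + R * K := by
    refine (abs_add_le _ _).trans ?_
    rw [abs_mul, abs_mul, abs_of_nonneg (Real.sqrt_nonneg r), abs_of_nonneg hr]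
    gcongr
  have h2 : |r| ≤ R := by rwa [abs_of_nonneg hr]
  simp only [channelPoint]
  gcongr

lemma integrable_comp_channelPoint [IsProbabilityMeasure P] (hK : ∀ᵐ x ∂P, |x| ≤ K)
    (hfc : Continuous (Function.uncurry f))
    (hf : ∀ y p, HasFDerivAt (f y) (fa y p • ContinuousLinearMap.fst ℝ ℝ ℝ
      + fr y p • ContinuousLinearMap.snd ℝ ℝ ℝ) p)
    (h0 : ∀ y, |y| ≤ K → |f y 0| ≤ C) (hba : ∀ y p, |y| ≤ K → |fa y p| ≤ C)
    (hbr : ∀ y p, |y| ≤ K → |fr y p| ≤ C) {r : ℝ} (hr : 0 ≤ r) :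
    Integrable (fun w ↦ f w.1 (channelPoint r w)) (P.prod (gaussianReal 0 1)) := by
  have hm : Continuous fun w : ℝ × ℝ ↦ f w.1 (channelPoint r w) :=
    hfc.comp (continuous_fst.prodMk (continuous_channelPoint.comp (continuous_const.prodMk
      continuous_id)))
  refine Integrable.mono' (g := fun w ↦ C + 2 * C * (√r * |w.2| + r * K + r)) ?_
    hm.aestronglyMeasurable ((ae_abs_fst_le hK).mono fun w hw ↦
      abs_comp_channelPoint_le hf h0 hba hbr hr le_rfl hw)
  have := integrable_abs_snd (P := P)
  fun_prop

/-- Gaussian integration by parts along the channel. -/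
lemma integral_channelPoint_mul_snd [IsProbabilityMeasure P] (hK : ∀ᵐ x ∂P, |x| ≤ K)
    (hfac : Continuous (Function.uncurry fa)) (hfaac : Continuous (Function.uncurry faa))
    (hfa : ∀ y a r, HasDerivAt (fun t ↦ fa y (t, r)) (faa y (a, r)) a)
    (hba : ∀ y p, |y| ≤ K → |fa y p| ≤ C) (hbaa : ∀ y p, |y| ≤ K → |faa y p| ≤ C) (r : ℝ) :
    ∫ w, fa w.1 (channelPoint r w) * w.2 ∂(P.prod (gaussianReal 0 1)) =
      √r * ∫ w, faa w.1 (channelPoint r w) ∂(P.prod (gaussianReal 0 1)) := by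
  have hm {g : ℝ → ℝ × ℝ → ℝ} (hg : Continuous (Function.uncurry g)) :
      Continuous fun w : ℝ × ℝ ↦ g w.1 (channelPoint r w) :=
    hg.comp (continuous_fst.prodMk (continuous_channelPoint.comp (continuous_const.prodMk
      continuous_id)))
  have i1 : Integrable (fun w : ℝ × ℝ ↦ fa w.1 (channelPoint r w) * w.2)
      (P.prod (gaussianReal 0 1)) := by
    have h2 : Integrable (fun w : ℝ × ℝ ↦ w.2) (P.prod (gaussianReal 0 1)) :=
      ((memLp_id_gaussianReal (μ := 0) (v := 1) 1).integrable (by simp)).comp_snd P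
    exact h2.bdd_mul (hm hfac).aestronglyMeasurable
      ((ae_abs_fst_le hK).mono fun w hw ↦ hba _ _ hw)
  have i2 : Integrable (fun w : ℝ × ℝ ↦ faa w.1 (channelPoint r w))
      (P.prod (gaussianReal 0 1)) :=
    Integrable.of_bound (hm hfaac).aestronglyMeasurable C
      ((ae_abs_fst_le hK).mono fun w hw ↦ hbaa _ _ hw)
  rw [integral_prod _ i1, integral_prod _ i2, ← integral_const_mul]
  refine integral_congr_ae (hK.mono fun y hy ↦ ?_)
  have hC : 0 ≤ C := (abs_nonneg _).trans (hba y 0 hy)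
  simp only
  rw [← integral_const_mul]
  refine integral_mul_gaussianReal_eq_integral_deriv (C := C + √r * C) (fun z ↦ ?_) ?_
    (fun z ↦ ?_) (fun z ↦ ?_)
  · have h1 : HasDerivAt (fun z ↦ √r * z + r * y) (√r) z := by
      simpa using ((hasDerivAt_id z).const_mul (√r)).add_const (r * y)
    exact ((hfa y _ r).comp z h1).congr_deriv (mul_comm _ _)
  · exact (((hm hfaac).comp (continuous_const.prodMk continuous_id)).const_mul _).measurable
  · exact (hba _ _ hy).trans (le_add_of_nonneg_right (by positivity))
  · rw [abs_mul, abs_of_nonneg (Real.sqrt_nonneg r)]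
    exact (mul_le_mul_of_nonneg_left (hbaa _ _ hy) (Real.sqrt_nonneg r)).trans
      (le_add_of_nonneg_left hC)

/-- Generator of the channel: differentiation in the signal-to-noise ratio `r > 0`. -/
lemma hasDerivAt_integral_channelPoint [IsProbabilityMeasure P] (hK : ∀ᵐ x ∂P, |x| ≤ K)
    (hfc : Continuous (Function.uncurry f)) (hfac : Continuous (Function.uncurry fa))
    (hfaac : Continuous (Function.uncurry faa)) (hfrc : Continuous (Function.uncurry fr))
    (hf : ∀ y p, HasFDerivAt (f y) (fa y p • ContinuousLinearMap.fst ℝ ℝ ℝ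
      + fr y p • ContinuousLinearMap.snd ℝ ℝ ℝ) p)
    (hfa : ∀ y a r, HasDerivAt (fun t ↦ fa y (t, r)) (faa y (a, r)) a)
    (h0 : ∀ y, |y| ≤ K → |f y 0| ≤ C) (hba : ∀ y p, |y| ≤ K → |fa y p| ≤ C)
    (hbaa : ∀ y p, |y| ≤ K → |faa y p| ≤ C) (hbr : ∀ y p, |y| ≤ K → |fr y p| ≤ C)
    {r : ℝ} (hr : 0 < r) :
    HasDerivAt (fun r ↦ ∫ w, f w.1 (channelPoint r w) ∂(P.prod (gaussianReal 0 1)))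
      (∫ w, (faa w.1 (channelPoint r w) / 2 + w.1 * fa w.1 (channelPoint r w)
        + fr w.1 (channelPoint r w)) ∂(P.prod (gaussianReal 0 1))) r := by
  have hm {g : ℝ → ℝ × ℝ → ℝ} (hg : Continuous (Function.uncurry g)) (r : ℝ) :
      Continuous fun w : ℝ × ℝ ↦ g w.1 (channelPoint r w) :=
    hg.comp (continuous_fst.prodMk (continuous_channelPoint.comp (continuous_const.prodMk
      continuous_id)))
  have hmfa := hm hfac
  have hmfr := hm hfrc
  have hsnd := integrable_abs_snd (P := P)
  have hs : 0 < √(r / 2) := Real.sqrt_pos.2 (half_pos hr)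
  refine HasDerivAt.congr_deriv (hasDerivAt_integral_of_dominated_loc_of_deriv_le
    (μ := P.prod (gaussianReal 0 1)) (F := fun r w ↦ f w.1 (channelPoint r w))
    (F' := fun r w ↦ fa w.1 (channelPoint r w) * (w.2 / (2 * √r) + w.1)
      + fr w.1 (channelPoint r w))
    (bound := fun w ↦ C * (|w.2| / (2 * √(r / 2)) + K) + C)
    (x₀ := r) (Ioi_mem_nhds (half_lt_self hr))
    (.of_forall fun q ↦ (hm hfc q).aestronglyMeasurable)
    (integrable_comp_channelPoint hK hfc hf h0 hba hbr hr.le)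
    (((hmfa r).mul (by fun_prop)).add (hmfr r)).aestronglyMeasurable ?_ (by fun_prop) ?_).2 ?_
  · filter_upwards [ae_abs_fst_le hK] with w hw q hq
    have hC : 0 ≤ C := (abs_nonneg _).trans (h0 _ hw)
    refine (abs_add_le _ _).trans (add_le_add ?_ (hbr _ _ hw))
    rw [abs_mul]
    refine mul_le_mul (hba _ _ hw) ((abs_add_le _ _).trans (add_le_add ?_ hw)) (abs_nonneg _) hC
    rw [abs_div, abs_of_nonneg (by positivity : 0 ≤ 2 * √q)]
    have := Real.sqrt_le_sqrt (mem_Ioi.1 hq).le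
    gcongr
  · refine .of_forall fun w q hq ↦ ?_
    have hq0 : 0 < q := (half_pos hr).trans hq
    have h1 : HasDerivAt (fun q ↦ √q * w.2 + q * w.1) (w.2 / (2 * √q) + w.1) q := by
      refine (((Real.hasDerivAt_sqrt hq0.ne').mul_const w.2).add
        ((hasDerivAt_id q).mul_const w.1)).congr_deriv ?_
      simp; ring
    have h2 : HasDerivAt (fun q ↦ channelPoint q w) (w.2 / (2 * √q) + w.1, 1) q :=
      h1.prodMk (hasDerivAt_id q)
    refine (HasFDerivAt.comp_hasDerivAt (f := fun q ↦ channelPoint q w) q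
      (hf w.1 (channelPoint q w)) h2).congr_deriv ?_
    simp
  · have hbd {g : ℝ → ℝ × ℝ → ℝ} (hg : Continuous (Function.uncurry g))
        (hb : ∀ y p, |y| ≤ K → |g y p| ≤ C) :
        Integrable (fun w : ℝ × ℝ ↦ g w.1 (channelPoint r w)) (P.prod (gaussianReal 0 1)) :=
      Integrable.of_bound (hm hg r).aestronglyMeasurable C
        ((ae_abs_fst_le hK).mono fun w hw ↦ hb _ _ hw)
    have h2 : Integrable (fun w : ℝ × ℝ ↦ w.2) (P.prod (gaussianReal 0 1)) :=
      ((memLp_id_gaussianReal (μ := 0) (v := 1) 1).integrable (by simp)).comp_snd P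
    have i1 : Integrable (fun w : ℝ × ℝ ↦ fa w.1 (channelPoint r w) * w.2)
        (P.prod (gaussianReal 0 1)) :=
      h2.bdd_mul (hmfa r).aestronglyMeasurable ((ae_abs_fst_le hK).mono fun w hw ↦ hba _ _ hw)
    have i2 : Integrable (fun w : ℝ × ℝ ↦ w.1 * fa w.1 (channelPoint r w))
        (P.prod (gaussianReal 0 1)) :=
      (hbd hfac hba).bdd_mul continuous_fst.aestronglyMeasurable (ae_abs_fst_le hK)
    have i3 := hbd hfrc hbr
    have i4 := hbd hfaac hbaa
    have e1 : ∫ w, (fa w.1 (channelPoint r w) * (w.2 / (2 * √r) + w.1)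
        + fr w.1 (channelPoint r w)) ∂(P.prod (gaussianReal 0 1)) =
        ∫ w, (fa w.1 (channelPoint r w) * w.2 / (2 * √r) + w.1 * fa w.1 (channelPoint r w)
        + fr w.1 (channelPoint r w)) ∂(P.prod (gaussianReal 0 1)) := by
      congr 1; ext; ring
    have add3 {g₁ g₂ g₃ : ℝ × ℝ → ℝ} (h₁ : Integrable g₁ (P.prod (gaussianReal 0 1)))
        (h₂ : Integrable g₂ (P.prod (gaussianReal 0 1)))
        (h₃ : Integrable g₃ (P.prod (gaussianReal 0 1))) :
        ∫ w, (g₁ w + g₂ w + g₃ w) ∂(P.prod (gaussianReal 0 1)) =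
          ∫ w, g₁ w ∂(P.prod (gaussianReal 0 1)) + ∫ w, g₂ w ∂(P.prod (gaussianReal 0 1))
            + ∫ w, g₃ w ∂(P.prod (gaussianReal 0 1)) := by
      rw [← integral_add h₁ h₂]
      exact integral_add (h₁.add h₂) h₃
    rw [e1, add3 (i1.div_const _) i2 i3, add3 (i4.div_const _) i2 i3, integral_div, integral_div,
      integral_channelPoint_mul_snd hK hfac hfaac hfa hba hbaa]
    have := Real.sqrt_pos.2 hr
    field_simp

lemma hasDerivWithinAt_integral_channelPoint [IsProbabilityMeasure P] (hK : ∀ᵐ x ∂P, |x| ≤ K)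
    (hfc : Continuous (Function.uncurry f)) (hfac : Continuous (Function.uncurry fa))
    (hfaac : Continuous (Function.uncurry faa)) (hfrc : Continuous (Function.uncurry fr))
    (hf : ∀ y p, HasFDerivAt (f y) (fa y p • ContinuousLinearMap.fst ℝ ℝ ℝ
      + fr y p • ContinuousLinearMap.snd ℝ ℝ ℝ) p)
    (hfa : ∀ y a r, HasDerivAt (fun t ↦ fa y (t, r)) (faa y (a, r)) a)
    (h0 : ∀ y, |y| ≤ K → |f y 0| ≤ C) (hba : ∀ y p, |y| ≤ K → |fa y p| ≤ C)
    (hbaa : ∀ y p, |y| ≤ K → |faa y p| ≤ C) (hbr : ∀ y p, |y| ≤ K → |fr y p| ≤ C)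
    {r : ℝ} (hr : 0 ≤ r) :
    HasDerivWithinAt (fun r ↦ ∫ w, f w.1 (channelPoint r w) ∂(P.prod (gaussianReal 0 1)))
      (∫ w, (faa w.1 (channelPoint r w) / 2 + w.1 * fa w.1 (channelPoint r w)
        + fr w.1 (channelPoint r w)) ∂(P.prod (gaussianReal 0 1))) (Ici 0) r := by
  have hpos {q : ℝ} (hq : 0 < q) :=
    hasDerivAt_integral_channelPoint hK hfc hfac hfaac hfrc hf hfa h0 hba hbaa hbr hq
  rcases hr.eq_or_lt with rfl | hr
  swap
  · exact (hpos hr).hasDerivWithinAt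
  have hm {g : ℝ → ℝ × ℝ → ℝ} (hg : Continuous (Function.uncurry g)) :
      Continuous fun q : ℝ × ℝ × ℝ ↦ g q.2.1 (channelPoint q.1 q.2) :=
    hg.comp (continuous_snd.fst.prodMk continuous_channelPoint)
  have hsnd := integrable_abs_snd (P := P)
  have hmem : Ioc (0 : ℝ) 1 ∈ 𝓝[>] (0 : ℝ) := Ioc_mem_nhdsGT one_pos
  refine hasDerivWithinAt_Ici_of_tendsto_deriv (s := Ioi 0)
    (fun q hq ↦ (hpos hq).differentiableAt.differentiableWithinAt) ?_ self_mem_nhdsWithin ?_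
  · refine tendsto_integral_filter_of_dominated_convergence
      (fun w ↦ C + 2 * C * (√1 * |w.2| + 1 * K + 1)) (.of_forall fun q ↦ ?_) ?_ (by fun_prop)
      (.of_forall fun w ↦ ?_)
    · exact ((hm hfc).comp (continuous_const.prodMk continuous_id)).aestronglyMeasurable
    · filter_upwards [hmem] with q hq
      exact (ae_abs_fst_le hK).mono fun w hw ↦
        abs_comp_channelPoint_le hf h0 hba hbr hq.1.le hq.2 hw
    · exact (((hm hfc).comp (continuous_id.prodMk continuous_const)).tendsto 0).mono_left
        nhdsWithin_le_nhds
  · refine Tendsto.congr' (eventually_mem_nhdsWithin.mono fun q hq ↦ (hpos hq).deriv.symm) ?_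
    have hc : Continuous fun q : ℝ × ℝ × ℝ ↦ faa q.2.1 (channelPoint q.1 q.2) / 2
        + q.2.1 * fa q.2.1 (channelPoint q.1 q.2) + fr q.2.1 (channelPoint q.1 q.2) := by
      have h1 := hm hfac
      have h2 := hm hfaac
      have h3 := hm hfrc
      exact ((h2.div_const 2).add (continuous_snd.fst.mul h1)).add h3
    refine tendsto_integral_filter_of_dominated_convergence
      (fun w ↦ C / 2 + K * C + C) (.of_forall fun q ↦ ?_) (.of_forall fun q ↦ ?_)
      (integrable_const _) (.of_forall fun w ↦ ?_)
    · exact (hc.comp (continuous_const.prodMk continuous_id)).aestronglyMeasurable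
    · refine (ae_abs_fst_le hK).mono fun w hw ↦ ?_
      have hK0 : 0 ≤ K := (abs_nonneg _).trans hw
      refine (norm_add₃_le).trans ?_
      simp only [Real.norm_eq_abs, abs_mul, abs_div, abs_two]
      have h1 := hba w.1 (channelPoint q w) hw
      have h2 := hbaa w.1 (channelPoint q w) hw
      have h3 := hbr w.1 (channelPoint q w) hw
      gcongr
    · exact ((hc.comp (continuous_id.prodMk continuous_const)).tendsto 0).mono_left
        nhdsWithin_le_nhds

end Heat

section FreeEnergy

variable {P : Measure ℝ} {K : ℝ}

lemma abs_mul_le_of_abs_le {a b A B : ℝ} (ha : |a| ≤ A) (hb : |b| ≤ B) : |a * b| ≤ A * B :=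
  (abs_mul a b).trans_le (mul_le_mul ha hb (abs_nonneg b) ((abs_nonneg a).trans ha))

lemma abs_sub_le_of_abs_le {a b A B : ℝ} (ha : |a| ≤ A) (hb : |b| ≤ B) : |a - b| ≤ A + B :=
  (abs_sub a b).trans (add_le_add ha hb)

/-- The Gibbs variance of `x`. -/
noncomputable def gibbsVar (P : Measure ℝ) (p : ℝ × ℝ) : ℝ :=
  gibbsMean P 2 p - gibbsMean P 1 p * gibbsMean P 1 p

/-- The third Gibbs cumulant of `x`. -/
noncomputable def gibbsCumulantThree (P : Measure ℝ) (p : ℝ × ℝ) : ℝ :=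
  gibbsMean P 3 p - gibbsMean P 2 p * gibbsMean P 1 p - 2 * gibbsMean P 1 p * gibbsVar P p

lemma hasDerivAt_gibbsMean_one [IsProbabilityMeasure P] (hK : ∀ᵐ x ∂P, |x| ≤ K) (a r : ℝ) :
    HasDerivAt (fun t ↦ gibbsMean P 1 (t, r)) (gibbsVar P (a, r)) a :=
  hasDerivAt_fst_of_hasFDerivAt (hasFDerivAt_gibbsMean hK 1 (a, r))

lemma hasDerivAt_gibbsVar [IsProbabilityMeasure P] (hK : ∀ᵐ x ∂P, |x| ≤ K) (a r : ℝ) :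
    HasDerivAt (fun t ↦ gibbsVar P (t, r)) (gibbsCumulantThree P (a, r)) a := by
  have h1 := hasDerivAt_gibbsMean_one hK a r
  have h2 := hasDerivAt_fst_of_hasFDerivAt (hasFDerivAt_gibbsMean hK 2 (a, r))
  refine (h2.sub (h1.mul h1)).congr_deriv ?_
  simp only [gibbsCumulantThree]
  ring

lemma abs_gibbsVar_le [IsProbabilityMeasure P] (hK : ∀ᵐ x ∂P, |x| ≤ K) (p : ℝ × ℝ) :
    |gibbsVar P p| ≤ 2 * K ^ 2 := by
  have hb := abs_gibbsMean_le hK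
  exact (abs_sub_le_of_abs_le (hb 2 p) (abs_mul_le_of_abs_le (hb 1 p) (hb 1 p))).trans_eq (by ring)

lemma abs_gibbsCumulantThree_le [IsProbabilityMeasure P] (hK : ∀ᵐ x ∂P, |x| ≤ K) (p : ℝ × ℝ) :
    |gibbsCumulantThree P p| ≤ 6 * K ^ 3 := by
  have hb := abs_gibbsMean_le hK
  exact (abs_sub_le_of_abs_le (abs_sub_le_of_abs_le (hb 3 p)
    (abs_mul_le_of_abs_le (hb 2 p) (hb 1 p))) (abs_mul_le_of_abs_le
      (abs_mul_le_of_abs_le abs_two.le (hb 1 p)) (abs_gibbsVar_le hK p))).trans_eq (by ring)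

lemma continuous_gibbsVar [IsProbabilityMeasure P] (hK : ∀ᵐ x ∂P, |x| ≤ K) :
    Continuous (gibbsVar P) :=
  (continuous_gibbsMean hK 2).sub ((continuous_gibbsMean hK 1).mul (continuous_gibbsMean hK 1))

lemma continuous_gibbsCumulantThree [IsProbabilityMeasure P] (hK : ∀ᵐ x ∂P, |x| ≤ K) :
    Continuous (gibbsCumulantThree P) := by
  have hc := continuous_gibbsMean hK
  exact ((hc 3).sub ((hc 2).mul (hc 1))).sub
    ((continuous_const.mul (hc 1)).mul (continuous_gibbsVar hK))

lemma nonneg_of_ae_abs_le [IsProbabilityMeasure P] (hK : ∀ᵐ x ∂P, |x| ≤ K) : 0 ≤ K :=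
  let ⟨_, hx⟩ := hK.exists
  (abs_nonneg _).trans hx

lemma continuous_log_gibbsMoment [IsProbabilityMeasure P] (hK : ∀ᵐ x ∂P, |x| ≤ K) :
    Continuous fun p ↦ Real.log (gibbsMoment P 0 p) :=
  continuous_iff_continuousAt.2 fun p ↦ (hasFDerivAt_log_gibbsMoment hK p).continuousAt

lemma abs_neg_half_gibbsMean_two_le [IsProbabilityMeasure P] (hK : ∀ᵐ x ∂P, |x| ≤ K)
    (p : ℝ × ℝ) : |-(gibbsMean P 2 p / 2)| ≤ K ^ 2 := by
  rw [abs_neg, abs_div, abs_two]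
  linarith [abs_gibbsMean_le hK 2 p, abs_nonneg (gibbsMean P 2 p)]

lemma abs_log_gibbsMoment_zero_le [IsProbabilityMeasure P] {C : ℝ} (hC : 0 ≤ C) :
    |Real.log (gibbsMoment P 0 0)| ≤ C := by
  simpa [gibbsMoment] using hC

lemma hasDerivWithinAt_integral_log [IsProbabilityMeasure P] (hK : ∀ᵐ x ∂P, |x| ≤ K) {r : ℝ}
    (hr : 0 ≤ r) :
    HasDerivWithinAt
      (fun r ↦ ∫ w, Real.log (gibbsMoment P 0 (channelPoint r w)) ∂(P.prod (gaussianReal 0 1)))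
      (∫ w, (w.1 * gibbsMean P 1 (channelPoint r w) - gibbsMean P 1 (channelPoint r w) ^ 2 / 2)
        ∂(P.prod (gaussianReal 0 1))) (Ici 0) r := by
  have hK0 := nonneg_of_ae_abs_le hK
  have hC : 0 ≤ K + 2 * K ^ 2 := by positivity
  refine (hasDerivWithinAt_integral_channelPoint (C := K + 2 * K ^ 2)
    (f := fun _ p ↦ Real.log (gibbsMoment P 0 p)) (fa := fun _ ↦ gibbsMean P 1)
    (faa := fun _ ↦ gibbsVar P) (fr := fun _ p ↦ -(gibbsMean P 2 p / 2)) hK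
    ((continuous_log_gibbsMoment hK).comp continuous_snd)
    ((continuous_gibbsMean hK 1).comp continuous_snd)
    ((continuous_gibbsVar hK).comp continuous_snd)
    (((continuous_gibbsMean hK 2).comp continuous_snd).div_const 2).neg
    (fun _ ↦ hasFDerivAt_log_gibbsMoment hK) (fun _ ↦ hasDerivAt_gibbsMean_one hK)
    (fun _ _ ↦ abs_log_gibbsMoment_zero_le hC) (fun _ p _ ↦ (abs_gibbsMean_le hK 1 p).trans ?_)
    (fun _ p _ ↦ (abs_gibbsVar_le hK p).trans ?_)
    (fun _ p _ ↦ (abs_neg_half_gibbsMean_two_le hK p).trans ?_) hr).congr_deriv ?_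
  · nlinarith
  · nlinarith
  · nlinarith
  · congr 1
    ext w
    simp only [gibbsVar]
    ring

lemma hasDerivWithinAt_integral_overlap [IsProbabilityMeasure P] (hK : ∀ᵐ x ∂P, |x| ≤ K) {r : ℝ}
    (hr : 0 ≤ r) :
    HasDerivWithinAt
      (fun r ↦ ∫ w, (w.1 * gibbsMean P 1 (channelPoint r w)
        - gibbsMean P 1 (channelPoint r w) ^ 2 / 2) ∂(P.prod (gaussianReal 0 1)))
      (∫ w, (((w.1 - gibbsMean P 1 (channelPoint r w)) * gibbsCumulantThree P (channelPoint r w)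
          - gibbsVar P (channelPoint r w) * gibbsVar P (channelPoint r w)) / 2
        + w.1 * ((w.1 - gibbsMean P 1 (channelPoint r w)) * gibbsVar P (channelPoint r w))
        + -1 / 2 * ((w.1 - gibbsMean P 1 (channelPoint r w)) *
          (gibbsMean P 3 (channelPoint r w)
            - gibbsMean P 1 (channelPoint r w) * gibbsMean P 2 (channelPoint r w))))
        ∂(P.prod (gaussianReal 0 1))) (Ici 0) r := by
  have hK0 := nonneg_of_ae_abs_le hK
  have hb := abs_gibbsMean_le hK
  have hc1 := continuous_gibbsMean hK 1
  have hc2 := continuous_gibbsMean hK 2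
  have hc3 := continuous_gibbsMean hK 3
  have hcv := continuous_gibbsVar hK
  have hck := continuous_gibbsCumulantThree hK
  have hdiff {y : ℝ} (hy : |y| ≤ K) (p : ℝ × ℝ) := abs_sub_le_of_abs_le hy (hb 1 p)
  refine hasDerivWithinAt_integral_channelPoint (C := 2 * K ^ 2 + 4 * K ^ 3 + 16 * K ^ 4)
    (f := fun y p ↦ y * gibbsMean P 1 p - gibbsMean P 1 p ^ 2 / 2)
    (fa := fun y p ↦ (y - gibbsMean P 1 p) * gibbsVar P p)
    (faa := fun y p ↦ (y - gibbsMean P 1 p) * gibbsCumulantThree P p - gibbsVar P p * gibbsVar P p)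
    (fr := fun y p ↦ -1 / 2 * ((y - gibbsMean P 1 p) *
      (gibbsMean P 3 p - gibbsMean P 1 p * gibbsMean P 2 p))) hK
    (by fun_prop) (by fun_prop) (by fun_prop) (by fun_prop) (fun y p ↦ ?_) (fun y a r ↦ ?_)
    (fun y hy ↦ ?_) (fun y p hy ↦ ?_) (fun y p hy ↦ ?_) (fun y p hy ↦ ?_) hr
  · have h1 := hasFDerivAt_gibbsMean hK 1 p
    have h2 : HasDerivAt (fun m : ℝ ↦ y * m - m ^ 2 / 2) (y - gibbsMean P 1 p)
        (gibbsMean P 1 p) := by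
      refine (((hasDerivAt_id _).const_mul y).sub
        ((hasDerivAt_pow 2 _).div_const 2)).congr_deriv ?_
      simp
    refine (h2.comp_hasFDerivAt p h1).congr_fderiv ?_
    ext
    · simp [gibbsVar]
    · simp
      ring
  · refine (((hasDerivAt_gibbsMean_one hK a r).const_sub y).mul
      (hasDerivAt_gibbsVar hK a r)).congr_deriv ?_
    ring
  · refine (abs_sub_le_of_abs_le (abs_mul_le_of_abs_le hy (hb 1 0)) (B := K ^ 2) ?_).trans ?_
    · rw [abs_div, abs_two, sq, sq]
      have := abs_mul_le_of_abs_le (hb 1 0) (hb 1 0)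
      simp only [pow_one] at this
      linarith [abs_nonneg (gibbsMean P 1 0 * gibbsMean P 1 0)]
    · linarith [pow_nonneg hK0 3, pow_nonneg hK0 4]
  · refine (abs_mul_le_of_abs_le (hdiff hy p) (abs_gibbsVar_le hK p)).trans ?_
    linarith [pow_nonneg hK0 2, pow_nonneg hK0 4]
  · refine (abs_sub_le_of_abs_le (abs_mul_le_of_abs_le (hdiff hy p)
      (abs_gibbsCumulantThree_le hK p)) (abs_mul_le_of_abs_le (abs_gibbsVar_le hK p)
        (abs_gibbsVar_le hK p))).trans ?_
    linarith [pow_nonneg hK0 2, pow_nonneg hK0 3]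
  · refine (abs_mul_le_of_abs_le (A := 1) (by norm_num [abs_div]) (abs_mul_le_of_abs_le (hdiff hy p)
      (abs_sub_le_of_abs_le (hb 3 p) (abs_mul_le_of_abs_le (hb 1 p) (hb 2 p))))).trans ?_
    linarith [pow_nonneg hK0 2, pow_nonneg hK0 3, pow_nonneg hK0 4]

end FreeEnergy

theorem stmt0 (P : Measure ℝ) [IsProbabilityMeasure P]
    (K : ℝ) (hK : ∀ᵐ x ∂P, |x| ≤ K)
    (ψ : ℝ → ℝ)
    (hψ : ∀ r : ℝ, ψ r =
      ∫ xs, ∫ z, Real.log (∫ x,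
          Real.exp (Real.sqrt r * z * x + r * x * xs - r / 2 * x ^ 2) ∂P)
        ∂(gaussianReal 0 1) ∂P) :
    ψ 0 = 0 ∧
    derivWithin ψ (Set.Ici 0) 0 = (1 / 2) * (∫ x, x ∂P) ^ 2 ∧
    ((∫ x, x ∂P) = 0 →
      derivWithin (derivWithin ψ (Set.Ici 0)) (Set.Ici 0) 0
        = (1 / 2) * (∫ x, x ^ 2 ∂P) ^ 2) := by
  have hK0 := nonneg_of_ae_abs_le hK
  have hcp (w : ℝ × ℝ) : channelPoint 0 w = 0 := by simp [channelPoint]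
  have hint {k : ℕ} : Integrable (fun x : ℝ ↦ x ^ k) P := by
    simpa using integrable_pow_mul_exp hK k 0
  have hfst (g : ℝ → ℝ) :
      ∫ w, g w.1 ∂(P.prod (gaussianReal 0 1)) = ∫ x, g x ∂P := by
    simpa using integral_fun_fst (μ := P) (ν := gaussianReal 0 1) g
  have hψ' (r : ℝ) (hr : r ∈ Ici (0 : ℝ)) : ψ r =
      ∫ w, Real.log (gibbsMoment P 0 (channelPoint r w)) ∂(P.prod (gaussianReal 0 1)) := by
    have hi : Integrable (fun w ↦ Real.log (gibbsMoment P 0 (channelPoint r w)))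
        (P.prod (gaussianReal 0 1)) :=
      integrable_comp_channelPoint (C := K + K ^ 2)
        (f := fun _ p ↦ Real.log (gibbsMoment P 0 p)) hK
        ((continuous_log_gibbsMoment hK).comp continuous_snd)
        (fun _ ↦ hasFDerivAt_log_gibbsMoment hK)
        (fun _ _ ↦ abs_log_gibbsMoment_zero_le (by positivity))
        (fun _ p _ ↦ (abs_gibbsMean_le hK 1 p).trans (by nlinarith))
        (fun _ p _ ↦ (abs_neg_half_gibbsMean_two_le hK p).trans (by linarith)) hr
    rw [hψ, integral_prod _ hi]
    simp only [gibbsMoment, channelPoint, pow_zero, one_mul]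
    congr! 8 with xs z x
    ring
  have hderiv (r : ℝ) (hr : r ∈ Ici (0 : ℝ)) : derivWithin ψ (Ici 0) r =
      ∫ w, (w.1 * gibbsMean P 1 (channelPoint r w) - gibbsMean P 1 (channelPoint r w) ^ 2 / 2)
        ∂(P.prod (gaussianReal 0 1)) :=
    ((hasDerivWithinAt_integral_log hK hr).congr hψ' (hψ' r hr)).derivWithin
      (uniqueDiffOn_Ici 0 r hr)
  have h0 : (0 : ℝ) ∈ Ici (0 : ℝ) := self_mem_Ici
  have hint1 : Integrable (fun x : ℝ ↦ x) P := by simpa using hint (k := 1)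
  refine ⟨?_, ?_, fun hcent ↦ ?_⟩
  · rw [hψ' 0 h0]
    simp [hcp, gibbsMoment]
  · rw [hderiv 0 h0]
    simp only [hcp, gibbsMean_zero_right, pow_one]
    rw [hfst fun y ↦ y * (∫ x, x ∂P) - (∫ x, x ∂P) ^ 2 / 2,
      integral_sub (hint1.mul_const _) (integrable_const _), integral_mul_const]
    simp
    ring
  · rw [((hasDerivWithinAt_integral_overlap hK le_rfl).congr hderiv (hderiv 0 h0)).derivWithin
      (uniqueDiffOn_Ici 0 0 h0)]
    simp only [hcp, gibbsCumulantThree, gibbsVar, gibbsMean_zero_right, pow_one, hcent]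
    have e (w : ℝ × ℝ) (v t : ℝ) : ((w.1 - 0) * (t - v * 0 - 2 * 0 * (v - 0 * 0))
        - (v - 0 * 0) * (v - 0 * 0)) / 2 + w.1 * ((w.1 - 0) * (v - 0 * 0))
        + -1 / 2 * ((w.1 - 0) * (t - 0 * v)) = w.1 ^ 2 * v - v ^ 2 / 2 := by ring
    simp only [e]
    rw [hfst fun y ↦ y ^ 2 * (∫ x, x ^ 2 ∂P) - (∫ x, x ^ 2 ∂P) ^ 2 / 2,
      integral_sub (hint.mul_const _) (integrable_const _), integral_mul_const]
    simp
    ring
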